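/- arXiv:2410.14266 — 7 statements merged into one kernel-verified Lean document; each statement's English description precedes it below -/
import Mathlib

section
/- Let H and G be real inner product spaces, let ν > 0, Δt > 0 and N a positive integer. Suppose σ^{n+1} ∈ G (for 0 ≤ n ≤ N−1) and ũ^{n+1} ∈ H (for 0 ≤ n ≤ N−1), u^n, q^n ∈ H (for 0 ≤ n ≤ N) satisfy, for every 0 ≤ n ≤ N−1: (i) ν^{-1}‖σ^{n+1}‖² + (1/Δt)⟨ũ^{n+1} − u^n, ũ^{n+1}⟩ + ⟨q^n, ũ^{n+1}⟩ = 0; (ii) ⟨u^{n+1} − ũ^{n+1}, u^{n+1}⟩ = 0; (iii) q^{n+1} = q^n − (1/Δt)(u^{n+1} − ũ^{n+1}); and (iv) ⟨q^m, u^k⟩ = 0 for all 0 ≤ m, k ≤ N. Then Δt · Σ_{n=0}^{N−1} ν^{-1}‖σ^{n+1}‖² + (1/2)‖u^N‖² + (1/2) Σ_{n=0}^{N−1} ‖u^{n+1} − ũ^{n+1}‖² + (Δt²/2)‖q^N‖² ≤ (1/2)‖u^0‖² + (Δt²/2)‖q^0‖². -/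
open RealInnerProductSpace Finset

theorem step_aux {H : Type*} [NormedAddCommGroup H] [InnerProductSpace ℝ H]
    (t S : ℝ) (ht : 0 < t) (v u0 u1 q0 q1 : H)
    (h1 : S + (1 / t) * ⟪v - u0, v⟫ + ⟪q0, v⟫ = 0)
    (h3 : q1 = q0 - (1 / t) • (u1 - v))
    (h00 : ⟪q0, u0⟫ = 0) (h01 : ⟪q0, u1⟫ = 0) (h10 : ⟪q1, u0⟫ = 0) (h11 : ⟪q1, u1⟫ = 0) :
    t * S + (1 / 2) * ‖u1‖ ^ 2 + (1 / 2) * ‖u1 - v‖ ^ 2 + (t ^ 2 / 2) * ‖q1‖ ^ 2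
      ≤ (1 / 2) * ‖u0‖ ^ 2 + (t ^ 2 / 2) * ‖q0‖ ^ 2 := by
  have hv : v = u1 - t • (q0 - q1) := by
    rw [h3, sub_sub_cancel, smul_smul, mul_one_div_cancel ht.ne', one_smul, sub_sub_cancel]
  have h1' : t * S + ⟪v - u0, v⟫ + t * ⟪q0, v⟫ = 0 := by
    have : t * (S + (1 / t) * ⟪v - u0, v⟫ + ⟪q0, v⟫) = 0 := by rw [h1, mul_zero]
    field_simp at this
    linarith
  clear h1 h3
  subst hv
  have hp : 0 ≤ ⟪u1 - u0, u1 - u0⟫ := real_inner_self_nonneg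
  rw [sub_sub_cancel]
  simp only [← real_inner_self_eq_norm_sq, inner_sub_left, inner_sub_right,
    real_inner_smul_left, real_inner_smul_right] at *
  have e1 : ⟪u0, q0⟫ = 0 := by rw [real_inner_comm, h00]
  have e2 : ⟪u1, q0⟫ = 0 := by rw [real_inner_comm, h01]
  have e3 : ⟪u0, q1⟫ = 0 := by rw [real_inner_comm, h10]
  have e4 : ⟪u1, q1⟫ = 0 := by rw [real_inner_comm, h11]
  rw [real_inner_comm u1 u0] at hp
  rw [real_inner_comm q1 q0] at *
  simp only [h00, h01, h10, h11, e1, e2, e3, e4] at h1' hp ⊢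
  rw [real_inner_comm u1 u0] at h1'
  nlinarith

/-- Unconditional stability of the fully discrete projection scheme (Theorem 3.1). -/
theorem stmt_0
    {H G : Type*} [NormedAddCommGroup H] [InnerProductSpace ℝ H]
    [NormedAddCommGroup G] [InnerProductSpace ℝ G]
    (ν Δt : ℝ) (hν : 0 < ν) (hΔt : 0 < Δt) (N : ℕ) (hN : 0 < N)
    (σ : ℕ → G) (ut u q : ℕ → H)
    (hpred : ∀ n < N, ν⁻¹ * ‖σ (n + 1)‖ ^ 2
      + (1 / Δt) * ⟪ut (n + 1) - u n, ut (n + 1)⟫ + ⟪q n, ut (n + 1)⟫ = 0)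
    (hproj : ∀ n < N, ⟪u (n + 1) - ut (n + 1), u (n + 1)⟫ = 0)
    (hq : ∀ n < N, q (n + 1) = q n - (1 / Δt) • (u (n + 1) - ut (n + 1)))
    (horth : ∀ m ≤ N, ∀ k ≤ N, ⟪q m, u k⟫ = 0) :
    Δt * ∑ n ∈ range N, ν⁻¹ * ‖σ (n + 1)‖ ^ 2
      + (1 / 2) * ‖u N‖ ^ 2
      + (1 / 2) * ∑ n ∈ range N, ‖u (n + 1) - ut (n + 1)‖ ^ 2
      + (Δt ^ 2 / 2) * ‖q N‖ ^ 2
      ≤ (1 / 2) * ‖u 0‖ ^ 2 + (Δt ^ 2 / 2) * ‖q 0‖ ^ 2 := by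
  clear hproj hN
  have key : ∀ M ≤ N, Δt * ∑ n ∈ range M, ν⁻¹ * ‖σ (n + 1)‖ ^ 2
      + (1 / 2) * ‖u M‖ ^ 2
      + (1 / 2) * ∑ n ∈ range M, ‖u (n + 1) - ut (n + 1)‖ ^ 2
      + (Δt ^ 2 / 2) * ‖q M‖ ^ 2
      ≤ (1 / 2) * ‖u 0‖ ^ 2 + (Δt ^ 2 / 2) * ‖q 0‖ ^ 2 := by
    intro M
    induction M with
    | zero => intro _; simp
    | succ n ih =>
      intro hn
      have h := step_aux Δt _ hΔt (ut (n + 1)) (u n) (u (n + 1)) (q n) (q (n + 1))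
        (hpred n hn) (hq n hn) (horth _ (by omega) _ (by omega)) (horth _ (by omega) _ (by omega))
        (horth _ (by omega) _ (by omega)) (horth _ (by omega) _ (by omega))
      have h' := ih (by omega)
      rw [sum_range_succ, sum_range_succ, mul_add, mul_add]
      linarith
  exact key N le_rfl
end

section
/- Let H and G be real inner product spaces, ν > 0, Δt > 0. Suppose σ ∈ G and ũ, u^old, u, q^old, q ∈ H satisfy: (i) ν^{-1}‖σ‖² + (1/Δt)⟨ũ − u^old, ũ⟩ + ⟨q^old, ũ⟩ = 0; (ii) ⟨u − ũ, u⟩ = 0; (iii) q = q^old − (1/Δt)(u − ũ); (iv) ⟨q, u⟩ = 0, ⟨q^old, u^old⟩ = 0, and ⟨q, u^old⟩ = 0. Then the single-step energy inequality holds: Δt ν^{-1}‖σ‖² + (1/2)(‖u‖² − ‖u^old‖²) + (1/2)‖u − ũ‖² + (Δt²/2)(‖q‖² − ‖q^old‖²) ≤ 0. -/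
open RealInnerProductSpace

/-- Single-step energy inequality for the projection scheme. -/
theorem stmt_1
    {H G : Type*} [NormedAddCommGroup H] [InnerProductSpace ℝ H]
    [NormedAddCommGroup G] [InnerProductSpace ℝ G]
    (ν Δt : ℝ) (hν : 0 < ν) (hΔt : 0 < Δt)
    (σ : G) (ut uold u qold q : H)
    (h1 : ν⁻¹ * ‖σ‖ ^ 2 + (1 / Δt) * ⟪ut - uold, ut⟫ + ⟪qold, ut⟫ = 0)
    (h2 : ⟪u - ut, u⟫ = 0)
    (h3 : q = qold - (1 / Δt) • (u - ut))
    (h4a : ⟪q, u⟫ = 0) (h4b : ⟪qold, uold⟫ = 0) (h4c : ⟪q, uold⟫ = 0) :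
    Δt * ν⁻¹ * ‖σ‖ ^ 2 + (1 / 2) * (‖u‖ ^ 2 - ‖uold‖ ^ 2)
      + (1 / 2) * ‖u - ut‖ ^ 2 + (Δt ^ 2 / 2) * (‖q‖ ^ 2 - ‖qold‖ ^ 2) ≤ 0 := by
  have hut : ut = u - Δt • (qold - q) := by
    rw [h3, sub_sub_cancel, smul_smul, mul_one_div_cancel hΔt.ne', one_smul, sub_sub_cancel]
  clear h3
  subst hut
  have hne := hΔt.ne'
  have h1' : Δt * ν⁻¹ * ‖σ‖ ^ 2 + ⟪u - Δt • (qold - q) - uold, u - Δt • (qold - q)⟫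
      + Δt * ⟪qold, u - Δt • (qold - q)⟫ = 0 := by
    have h := congrArg (fun x => Δt * x) h1
    simp only [mul_add, mul_zero, ← mul_assoc, mul_one_div_cancel hne, one_mul] at h
    exact h
  have h5 : ⟪qold, u⟫ = 0 := by
    rw [sub_sub_cancel, inner_smul_left, inner_sub_left, h4a] at h2
    simpa [hne] using h2
  have hp : 0 ≤ ⟪u - uold, u - uold⟫ := real_inner_self_nonneg
  rw [sub_sub_cancel, ← real_inner_self_eq_norm_sq u, ← real_inner_self_eq_norm_sq uold,
    ← real_inner_self_eq_norm_sq q, ← real_inner_self_eq_norm_sq qold,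
    ← real_inner_self_eq_norm_sq (Δt • (qold - q))]
  simp only [inner_sub_left, inner_sub_right, real_inner_smul_left, real_inner_smul_right,
    real_inner_comm qold u, real_inner_comm q u, real_inner_comm qold uold,
    real_inner_comm q uold, real_inner_comm u uold, real_inner_comm qold q,
    h4a, h4b, h4c, h5] at h1' hp ⊢
  have e1 := real_inner_comm qold u
  have e2 := real_inner_comm q u
  have e3 := real_inner_comm qold uold
  have e4 := real_inner_comm q uold
  have e5 := real_inner_comm u uold
  have e6 := real_inner_comm qold q
  try simp only [e5, e6] at h1' hp ⊢
  nlinarith [h1', hp]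
end

section
/- Let H and G be real inner product spaces, ν > 0, C₁ ≥ 0, T_f > 0, N a positive integer, and Δt = T_f/N with Δt ≤ 1. Suppose eσ^{n+1} ∈ G, eũ^{n+1}, T^{n+1}, S^{n+1} ∈ H (for 0 ≤ n ≤ N−1) and eu^n, eq^n ∈ H (for 0 ≤ n ≤ N) satisfy, for all 0 ≤ n ≤ N−1: (i) ν^{-1}‖eσ^{n+1}‖² + (1/Δt)⟨eũ^{n+1} − eu^n, eũ^{n+1}⟩ + ⟨eq^n, eũ^{n+1}⟩ = ⟨T^{n+1}, eũ^{n+1}⟩ − ⟨S^{n+1}, eũ^{n+1}⟩; (ii) ⟨eu^{n+1} − eũ^{n+1}, eu^{n+1}⟩ = 0; (iii) eq^{n+1} = eq^n − (1/Δt)(eu^{n+1} − eũ^{n+1}) + S^{n+1}; (iv) ⟨eq^m, eu^k⟩ = 0 and ⟨S^{m+1}, eu^k⟩ = 0 for all admissible indices m, k; (v) ‖T^{n+1}‖ ≤ C₁Δt and ‖S^{n+1}‖ ≤ C₁Δt for all n; (vi) eu^0 = 0 and eq^0 = 0. Then there exists a constant C depending only on C₁ and T_f (independent of Δt, N, ν)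 such that Δt · Σ_{n=0}^{N−1} ν^{-1}‖eσ^{n+1}‖² + ‖eu^N‖² + Δt²‖eq^N‖² ≤ C Δt². -/
open RealInnerProductSpace Finset

lemma step_aux_s3 {H : Type} [NormedAddCommGroup H] [InnerProductSpace ℝ H]
    (c k s : ℝ) (hk : 0 < k) (hk1 : k ≤ 1) (hc : 0 ≤ c) (a u v p p' T S : H)
    (h1 : s + (1 / k) * ⟪a - u, a⟫ + ⟪p, a⟫ = ⟪T, a⟫ - ⟪S, a⟫)
    (h2 : ⟪v - a, v⟫ = 0)
    (h3 : p' = p - (1 / k) • (v - a) + S)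
    (hpv : ⟪p, v⟫ = 0) (hSv : ⟪S, v⟫ = 0)
    (hT : ‖T‖ ≤ c * k) (hS : ‖S‖ ≤ c * k) :
    2 * k * s + ‖v‖ ^ 2 + k ^ 2 * ‖p'‖ ^ 2
      ≤ (1 + k) * (‖u‖ ^ 2 + k ^ 2 * ‖p‖ ^ 2) + 4 * c ^ 2 * k ^ 3 := by
  obtain ⟨w, rfl⟩ : ∃ w, a = v + w := ⟨a - v, by abel⟩
  have e3 : k • p' = k • p + w + k • S := by
    rw [h3, smul_add, smul_sub, smul_smul, mul_one_div_cancel hk.ne']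
    simp
  have n3 : k ^ 2 * ‖p'‖ ^ 2 = k ^ 2 * ‖p‖ ^ 2 + ‖w‖ ^ 2 + k ^ 2 * ‖S‖ ^ 2
      + 2 * k * ⟪p, w⟫ + 2 * k ^ 2 * ⟪p, S⟫ + 2 * k * ⟪S, w⟫ := by
    have : k ^ 2 * ‖p'‖ ^ 2 = ‖k • p'‖ ^ 2 := by
      rw [norm_smul, mul_pow, Real.norm_eq_abs, sq_abs]
    rw [this, e3]
    simp only [← real_inner_self_eq_norm_sq, inner_add_left, inner_add_right,
      real_inner_smul_left, real_inner_smul_right]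
    rw [real_inner_comm p w, real_inner_comm p S, real_inner_comm S w]
    ring
  have hwv : ⟪w, v⟫ = 0 := by
    simpa using h2
  have hvw : ⟪v, w⟫ = 0 := by rw [real_inner_comm]; exact hwv
  have g1 : k * s + ⟪v + w - u, v + w⟫ + k * ⟪p, v + w⟫
      = k * ⟪T, v + w⟫ - k * ⟪S, v + w⟫ := by
    have := congrArg (fun x => k * x) h1
    field_simp at this
    linarith
  have q1 : 0 ≤ ‖(v + w - u) - k • T‖ ^ 2 := by positivity
  have q2 : 0 ≤ k * ‖u - T‖ ^ 2 := by positivity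
  have q3 : 0 ≤ k * ‖k • p - S‖ ^ 2 := by positivity
  have hT2 : ‖T‖ ^ 2 ≤ c ^ 2 * k ^ 2 := by
    rw [← mul_pow]; gcongr
  have hS2 : ‖S‖ ^ 2 ≤ c ^ 2 * k ^ 2 := by
    rw [← mul_pow]; gcongr
  have b1 : (k ^ 2 + k) * ‖T‖ ^ 2 ≤ 2 * c ^ 2 * k ^ 3 := by
    calc (k ^ 2 + k) * ‖T‖ ^ 2 ≤ (2 * k) * (c ^ 2 * k ^ 2) := by
          gcongr; nlinarith
      _ = _ := by ring
  have b2 : (k ^ 2 + k) * ‖S‖ ^ 2 ≤ 2 * c ^ 2 * k ^ 3 := by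
    calc (k ^ 2 + k) * ‖S‖ ^ 2 ≤ (2 * k) * (c ^ 2 * k ^ 2) := by
          gcongr; nlinarith
      _ = _ := by ring
  rw [n3]
  simp only [← real_inner_self_eq_norm_sq, inner_add_left, inner_add_right, inner_sub_left,
    inner_sub_right, real_inner_smul_left, real_inner_smul_right, hpv, hSv, hwv, hvw]
    at g1 q1 q2 q3 b1 b2 ⊢
  rw [real_inner_comm v u] at *
  simp only [real_inner_comm T v, real_inner_comm T w, real_inner_comm T u,
    real_inner_comm w u, real_inner_comm p S] at *
  linarith

/-- First order in time convergence of the projection scheme (Theorem 3.2),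
stated abstractly: the constant `C` depends only on `C₁` and the final time `Tf`. -/
theorem stmt_3 (C₁ Tf : ℝ) (hC₁ : 0 ≤ C₁) (hTf : 0 < Tf) :
    ∃ C : ℝ, ∀ (H : Type) [NormedAddCommGroup H] [InnerProductSpace ℝ H]
      (G : Type) [NormedAddCommGroup G] [InnerProductSpace ℝ G]
      (ν Δt : ℝ) (N : ℕ), 0 < ν → 0 < N → Δt = Tf / (N : ℝ) → Δt ≤ 1 →
      ∀ (eσ : ℕ → G) (eut T S eu eq : ℕ → H),
      (∀ n < N, ν⁻¹ * ‖eσ (n + 1)‖ ^ 2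
          + (1 / Δt) * ⟪eut (n + 1) - eu n, eut (n + 1)⟫ + ⟪eq n, eut (n + 1)⟫
          = ⟪T (n + 1), eut (n + 1)⟫ - ⟪S (n + 1), eut (n + 1)⟫) →
      (∀ n < N, ⟪eu (n + 1) - eut (n + 1), eu (n + 1)⟫ = 0) →
      (∀ n < N, eq (n + 1) = eq n - (1 / Δt) • (eu (n + 1) - eut (n + 1)) + S (n + 1)) →
      (∀ m ≤ N, ∀ k ≤ N, ⟪eq m, eu k⟫ = 0) →
      (∀ m < N, ∀ k ≤ N, ⟪S (m + 1), eu k⟫ = 0) →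
      (∀ n < N, ‖T (n + 1)‖ ≤ C₁ * Δt) →
      (∀ n < N, ‖S (n + 1)‖ ≤ C₁ * Δt) →
      eu 0 = 0 → eq 0 = 0 →
      Δt * ∑ n ∈ range N, ν⁻¹ * ‖eσ (n + 1)‖ ^ 2 + ‖eu N‖ ^ 2 + Δt ^ 2 * ‖eq N‖ ^ 2
        ≤ C * Δt ^ 2 := by
  refine ⟨Tf * (4 * C₁ ^ 2) * Real.exp Tf, ?_⟩
  intro H _ _ G _ _ ν k N hν hN hk hk1 eσ eut T S eu eq h1 h2 h3 h4 h5 h6 h7 hu0 hq0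
  have hN' : (0 : ℝ) < N := by exact_mod_cast hN
  have hk0 : 0 < k := by rw [hk]; positivity
  have hNk : (N : ℝ) * k = Tf := by rw [hk]; field_simp
  have key : ∀ n ≤ N, k * ∑ i ∈ range n, ν⁻¹ * ‖eσ (i + 1)‖ ^ 2 + ‖eu n‖ ^ 2
      + k ^ 2 * ‖eq n‖ ^ 2 ≤ n * (4 * C₁ ^ 2 * k ^ 3) * Real.exp (n * k) := by
    intro n
    induction n with
    | zero => intro _; simp [hu0, hq0]
    | succ n ih =>
      intro hn
      have hn' : n < N := hn
      have ih := ih hn'.le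
      have st := step_aux_s3 C₁ k _ hk0 hk1 hC₁ _ _ _ _ _ _ _ (h1 n hn') (h2 n hn') (h3 n hn')
        (h4 n hn'.le (n + 1) hn) (h5 n hn' (n + 1) hn) (h6 n hn') (h7 n hn')
      rw [sum_range_succ]
      have s0 : 0 ≤ ∑ i ∈ range n, ν⁻¹ * ‖eσ (i + 1)‖ ^ 2 :=
        sum_nonneg fun i _ => by positivity
      have s1 : 0 ≤ k * (ν⁻¹ * ‖eσ (n + 1)‖ ^ 2) := by positivity
      have s2 : 0 ≤ k * (k * ∑ i ∈ range n, ν⁻¹ * ‖eσ (i + 1)‖ ^ 2) := by positivity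
      have m1 := mul_le_mul_of_nonneg_left ih (by linarith : (0 : ℝ) ≤ 1 + k)
      have ek : 1 + k ≤ Real.exp k := by linarith [Real.add_one_le_exp k]
      have ex : Real.exp (((n + 1 : ℕ) : ℝ) * k) = Real.exp (n * k) * Real.exp k := by
        rw [← Real.exp_add]; push_cast; ring_nf
      have e1 : 1 ≤ Real.exp (((n + 1 : ℕ) : ℝ) * k) := Real.one_le_exp (by positivity)
      have m2 : (1 + k) * (n * (4 * C₁ ^ 2 * k ^ 3) * Real.exp (n * k))
          ≤ n * (4 * C₁ ^ 2 * k ^ 3) * Real.exp (((n + 1 : ℕ) : ℝ) * k) := by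
        rw [ex]
        calc _ ≤ Real.exp k * (n * (4 * C₁ ^ 2 * k ^ 3) * Real.exp (n * k)) := by gcongr
          _ = _ := by ring
      have m3 : 4 * C₁ ^ 2 * k ^ 3 ≤ 4 * C₁ ^ 2 * k ^ 3 * Real.exp (((n + 1 : ℕ) : ℝ) * k) :=
        le_mul_of_one_le_right (by positivity) e1
      have m4 : ((n + 1 : ℕ) : ℝ) * (4 * C₁ ^ 2 * k ^ 3) * Real.exp (((n + 1 : ℕ) : ℝ) * k)
          = n * (4 * C₁ ^ 2 * k ^ 3) * Real.exp (((n + 1 : ℕ) : ℝ) * k)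
            + 4 * C₁ ^ 2 * k ^ 3 * Real.exp (((n + 1 : ℕ) : ℝ) * k) := by
        push_cast; ring
      rw [m4]
      linarith
  refine (key N le_rfl).trans (le_of_eq ?_)
  rw [hNk, ← hNk]
  ring
end

section
/- Let H and G be real inner product spaces, ν > 0, Δt > 0. Suppose eσ ∈ G and eũ, eu^old, eu, eq^old, eq, T, S ∈ H satisfy: (i) ν^{-1}‖eσ‖² + (1/Δt)⟨eũ − eu^old, eũ⟩ + ⟨eq^old, eũ⟩ = ⟨T, eũ⟩ − ⟨S, eũ⟩; (ii) ⟨eu − eũ, eu⟩ = 0; (iii) eq = eq^old − (1/Δt)(eu − eũ) + S; (iv) ⟨eq, eu⟩ = 0, ⟨eq^old, eu^old⟩ = 0, ⟨eq, eu^old⟩ = 0, ⟨S, eu⟩ = 0. Then the single-step error inequality holds: Δt ν^{-1}‖eσ‖² + (1/2)(‖eu‖² − ‖eu^old‖²) + (Δt²/2)(‖eq‖² − ‖eq^old‖²) ≤ (Δt² + Δt)‖T‖² + (Δt² + Δt)‖S‖² + (Δt/4)‖eu‖² + (Δt³/4)‖eq‖². -/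
open RealInnerProductSpace

/-- Single-step error inequality (inequality (eq:err-6) of the paper). -/
theorem stmt_4
    {H G : Type*} [NormedAddCommGroup H] [InnerProductSpace ℝ H]
    [NormedAddCommGroup G] [InnerProductSpace ℝ G]
    (ν Δt : ℝ) (hν : 0 < ν) (hΔt : 0 < Δt)
    (eσ : G) (eut euold eu eqold eq T S : H)
    (h1 : ν⁻¹ * ‖eσ‖ ^ 2 + (1 / Δt) * ⟪eut - euold, eut⟫ + ⟪eqold, eut⟫
        = ⟪T, eut⟫ - ⟪S, eut⟫)
    (h2 : ⟪eu - eut, eu⟫ = 0)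
    (h3 : eq = eqold - (1 / Δt) • (eu - eut) + S)
    (h4a : ⟪eq, eu⟫ = 0) (h4b : ⟪eqold, euold⟫ = 0) (h4c : ⟪eq, euold⟫ = 0)
    (h4d : ⟪S, eu⟫ = 0) :
    Δt * ν⁻¹ * ‖eσ‖ ^ 2 + (1 / 2) * (‖eu‖ ^ 2 - ‖euold‖ ^ 2)
      + (Δt ^ 2 / 2) * (‖eq‖ ^ 2 - ‖eqold‖ ^ 2)
      ≤ (Δt ^ 2 + Δt) * ‖T‖ ^ 2 + (Δt ^ 2 + Δt) * ‖S‖ ^ 2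
        + (Δt / 4) * ‖eu‖ ^ 2 + (Δt ^ 3 / 4) * ‖eq‖ ^ 2 := by
  obtain ⟨v, hv⟩ : ∃ v : H, v = (1 / Δt) • (eut - eu) := ⟨_, rfl⟩
  have hk : Δt ≠ 0 := hΔt.ne'
  have hut : eut = eu + Δt • v := by
    rw [hv, smul_smul, mul_one_div_cancel hk, one_smul]; abel
  have hp : eqold = eq - v - S := by
    rw [h3, hv, smul_sub, smul_sub]; abel
  clear h3 hv
  subst hut
  subst hp
  have h1' : Δt * (ν⁻¹ * ‖eσ‖ ^ 2) + ⟪eu + Δt • v - euold, eu + Δt • v⟫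
      + Δt * ⟪eq - v - S, eu + Δt • v⟫
        = Δt * (⟪T, eu + Δt • v⟫ - ⟪S, eu + Δt • v⟫) := by
    rw [← h1]; field_simp
  clear h1
  have a1 := real_inner_self_nonneg (x := eu - euold - Δt • S)
  have a2 := mul_nonneg hΔt.le (real_inner_self_nonneg (x := T - (1 / 2 : ℝ) • eu))
  have a3 := mul_nonneg hΔt.le (real_inner_self_nonneg (x := S - (Δt / 2) • eq))
  have a4 := real_inner_self_nonneg (x := Δt • v + Δt • S - Δt • T)
  have a5 := mul_nonneg (sq_nonneg Δt) (real_inner_self_nonneg (x := T + S))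
  have e : ∀ x : H, ‖x‖ ^ 2 = ⟪x, x⟫ := fun x => (real_inner_self_eq_norm_sq x).symm
  simp only [e eu, e euold, e eq, e T, e S, e (eq - v - S)]
  have h2' : Δt * ⟪v, eu⟫ = 0 := by
    have : eu - (eu + Δt • v) = -(Δt • v) := by abel
    rw [this, inner_neg_left, real_inner_smul_left] at h2
    linarith
  have h2'' : ⟪v, eu⟫ = 0 := (mul_eq_zero.mp h2').resolve_left hk
  clear h2 h2'
  simp only [inner_add_left, inner_add_right, inner_sub_left, inner_sub_right,
    real_inner_smul_left, real_inner_smul_right, real_inner_comm eu euold,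
    real_inner_comm eu eq, real_inner_comm eu S, real_inner_comm eu T, real_inner_comm eu v,
    real_inner_comm euold eq, real_inner_comm euold S, real_inner_comm euold T,
    real_inner_comm euold v, real_inner_comm eq S, real_inner_comm eq T, real_inner_comm eq v,
    real_inner_comm S T, real_inner_comm S v, real_inner_comm T v] at *
  have hvo : ⟪euold, v⟫ = -⟪euold, S⟫ := by linarith
  rw [h2'', h4a, h4d, hvo] at h1'
  rw [h4d] at a1
  linarith
end

section
/- Let J be an invertible 2×2 real matrix with det J > 0, b ∈ ℝ², and F(x̂) = J x̂ + b. Let R : ℝ² → ℝ² be the clockwise rotation by 90 degrees, R(x, y) = (y, −x). Let â ≠ b̂ be points in ℝ², set t̂ = b̂ − â and t = J t̂, and define the unit normals n̂ = R t̂ / ‖t̂‖ and n = R t / ‖t‖ to the segments [â, b̂] and [F(â), F(b̂)] respectively. Let v̂ : ℝ² → ℝ² be any function and define the Piola transform v(x) = (1/det J) · J · v̂(F⁻¹(x)). Then for every x̂ ∈ ℝ²: ⟨v(F(x̂)), n⟩ = (‖t̂‖ / ‖t‖) · ⟨v̂(x̂), n̂⟩; equivalently, |e| · ⟨v∘F,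 n⟩ = |ê| · ⟨v̂, n̂⟩ pointwise, where |ê| = ‖t̂‖ and |e| = ‖t‖ are the lengths of the reference and mapped segments. -/
/-- Euclidean norm on ℝ². -/
noncomputable def enorm2 (z : ℝ × ℝ) : ℝ := Real.sqrt (z.1 ^ 2 + z.2 ^ 2)

/-- Euclidean inner product on ℝ². -/
def einner2 (z w : ℝ × ℝ) : ℝ := z.1 * w.1 + z.2 * w.2

/-- Clockwise rotation by 90 degrees, `R(x,y) = (y, -x)`. -/
def rot2 (z : ℝ × ℝ) : ℝ × ℝ := (z.2, -z.1)

/-- Edge normal-component identity of the Piola transformation (eq:Piola2):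
`⟪v ∘ F, n⟫ = (|ê|/|e|) ⟪v̂, n̂⟫` pointwise, equivalently `|e| ⟪v∘F, n⟫ = |ê| ⟪v̂, n̂⟫`. -/
theorem stmt_10 (J : Matrix (Fin 2) (Fin 2) ℝ) (hJ : 0 < J.det) (b : ℝ × ℝ)
    (Jact : ℝ × ℝ → ℝ × ℝ)
    (hJact : ∀ z, Jact z = (J 0 0 * z.1 + J 0 1 * z.2, J 1 0 * z.1 + J 1 1 * z.2))
    (F : ℝ × ℝ → ℝ × ℝ) (hF : ∀ z, F z = Jact z + b)
    (Finv : ℝ × ℝ → ℝ × ℝ) (hFinv₁ : ∀ z, Finv (F z) = z) (hFinv₂ : ∀ z, F (Finv z) = z)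
    (ahat bhat : ℝ × ℝ) (hab : ahat ≠ bhat)
    (that t : ℝ × ℝ) (hthat : that = bhat - ahat) (ht : t = Jact that)
    (nhat n : ℝ × ℝ)
    (hnhat : nhat = (enorm2 that)⁻¹ • rot2 that) (hn : n = (enorm2 t)⁻¹ • rot2 t)
    (vhat : ℝ × ℝ → ℝ × ℝ) (v : ℝ × ℝ → ℝ × ℝ)
    (hv : ∀ x, v x = (J.det)⁻¹ • Jact (vhat (Finv x))) :
    ∀ xhat : ℝ × ℝ,
      einner2 (v (F xhat)) n = (enorm2 that / enorm2 t) * einner2 (vhat xhat) nhat ∧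
      enorm2 t * einner2 (v (F xhat)) n = enorm2 that * einner2 (vhat xhat) nhat := by
  have key : ∀ z : ℝ × ℝ, enorm2 z = 0 → z.1 = 0 ∧ z.2 = 0 := by
    intro z hz
    unfold enorm2 at hz
    rw [Real.sqrt_eq_zero (by positivity)] at hz
    constructor <;> nlinarith [sq_nonneg z.1, sq_nonneg z.2]
  have h1 : enorm2 that ≠ 0 := by
    intro h
    obtain ⟨h1, h2⟩ := key _ h
    apply hab
    rw [hthat] at h1 h2
    simp only [Prod.fst_sub, Prod.snd_sub] at h1 h2
    ext <;> linarith
  have hd : J.det = J 0 0 * J 1 1 - J 0 1 * J 1 0 := Matrix.det_fin_two J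
  have hd0 : J.det ≠ 0 := hJ.ne'
  have h2 : enorm2 t ≠ 0 := by
    intro h
    obtain ⟨e1, e2⟩ := key _ h
    rw [ht, hJact] at e1 e2
    simp only at e1 e2
    apply h1
    have f1 : J.det * that.1 = 0 := by
      rw [hd]; linear_combination J 1 1 * e1 - J 0 1 * e2
    have f2 : J.det * that.2 = 0 := by
      rw [hd]; linear_combination J 0 0 * e2 - J 1 0 * e1
    have g1 := (mul_eq_zero.mp f1).resolve_left hd0
    have g2 := (mul_eq_zero.mp f2).resolve_left hd0
    simp [enorm2, g1, g2]
  intro xhat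
  have main : enorm2 t * einner2 (v (F xhat)) n = enorm2 that * einner2 (vhat xhat) nhat := by
    rw [hv, hFinv₁, hn, hnhat]
    generalize vhat xhat = w
    have e1 : t.1 = J 0 0 * that.1 + J 0 1 * that.2 := by rw [ht, hJact]
    have e2 : t.2 = J 1 0 * that.1 + J 1 1 * that.2 := by rw [ht, hJact]
    simp only [einner2, rot2, hJact, Prod.smul_fst, Prod.smul_snd, smul_eq_mul]
    field_simp
    rw [e1, e2, hd]
    ring
  refine ⟨?_, main⟩
  rw [div_mul_eq_mul_div, eq_div_iff h2, ← main]
  ring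
end

section
/- Let V(Ê) = (P₁)² + x P₁ be the space of functions ℝ² → ℝ² of the form x̂ ↦ p(x̂) + q(x̂)·x̂ with p having components of total degree at most 1 and q a scalar polynomial of total degree at most 1. Then the divergence operator maps V(Ê) onto P₁: for every polynomial w : ℝ² → ℝ of total degree at most 1 there exists v ∈ V(Ê) with div v = w identically on ℝ². -/
/-- The divergence `∂w₁/∂x + ∂w₂/∂y` of a vector field `w : ℝ² → ℝ²`. -/
noncomputable def pdiv (w : ℝ × ℝ → ℝ × ℝ) (x : ℝ × ℝ) : ℝ :=
  (fderiv ℝ w x (1, 0)).1 + (fderiv ℝ w x (0, 1)).2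

open MvPolynomial in
theorem decomp_aux (w : MvPolynomial (Fin 2) ℝ) (hw : w.totalDegree ≤ 1) :
    ∃ a b c : ℝ, w = C a + C b * X 0 + C c * X 1 := by
  refine ⟨w.coeff 0, w.coeff (Finsupp.single 0 1), w.coeff (Finsupp.single 1 1), ?_⟩
  ext m
  have hext : ∀ n : Fin 2 →₀ ℕ, n = m ↔ (n 0 = m 0 ∧ n 1 = m 1) := by
    intro n
    rw [Finsupp.ext_iff, Fin.forall_fin_two]
  simp only [coeff_add, coeff_C, coeff_C_mul, coeff_X', hext]
  by_cases hm : m 0 + m 1 ≤ 1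
  · have h3 : (m 0 = 0 ∧ m 1 = 0) ∨ (m 0 = 1 ∧ m 1 = 0) ∨ (m 0 = 0 ∧ m 1 = 1) := by omega
    rcases h3 with h | h | h
    · have : (0 : Fin 2 →₀ ℕ) = m := by rw [hext]; simp [h]
      subst this; simp
    · have : Finsupp.single (0 : Fin 2) 1 = m := by rw [hext]; simp [h]
      subst this; simp
    · have : Finsupp.single (1 : Fin 2) 1 = m := by rw [hext]; simp [h]
      subst this; simp
  · have h0 : w.coeff m = 0 := by
      apply coeff_eq_zero_of_totalDegree_lt
      have : ∑ i ∈ m.support, m i = m 0 + m 1 := by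
        have := Finsupp.sum_fintype m (fun _ k => k) (by simp)
        simpa [Finsupp.sum, Fin.sum_univ_two] using this
      omega
    rw [h0, if_neg, if_neg, if_neg]
    · simp
    all_goals
      simp
      omega

open MvPolynomial in
theorem deg_aux (b c : ℝ) : (C b * X 0 + C c * X 1 : MvPolynomial (Fin 2) ℝ).totalDegree ≤ 1 := by
  refine (totalDegree_add _ _).trans (max_le ?_ ?_) <;>
  · refine (totalDegree_mul _ _).trans ?_
    simp

/-- The divergence maps the local Raviart–Thomas space `RT₁ = (P₁)² + x P₁`
onto `P₁`: every polynomial `w` of total degree at most 1 is the divergence of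
some element of `RT₁`. -/
theorem stmt_12 (w : MvPolynomial (Fin 2) ℝ) (hw : w.totalDegree ≤ 1) :
    ∃ p₁ p₂ q : MvPolynomial (Fin 2) ℝ,
      p₁.totalDegree ≤ 1 ∧ p₂.totalDegree ≤ 1 ∧ q.totalDegree ≤ 1 ∧
      ∀ x : ℝ × ℝ,
        pdiv (fun y : ℝ × ℝ =>
            (MvPolynomial.eval ![y.1, y.2] p₁ + MvPolynomial.eval ![y.1, y.2] q * y.1,
             MvPolynomial.eval ![y.1, y.2] p₂ + MvPolynomial.eval ![y.1, y.2] q * y.2)) x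
          = MvPolynomial.eval ![x.1, x.2] w := by
  obtain ⟨a, b, c, rfl⟩ := decomp_aux w hw
  refine ⟨MvPolynomial.C a * MvPolynomial.X 0 + MvPolynomial.C 0 * MvPolynomial.X 1, 0,
    MvPolynomial.C (b/3) * MvPolynomial.X 0 + MvPolynomial.C (c/3) * MvPolynomial.X 1,
    deg_aux _ _, by simp, deg_aux _ _, ?_⟩
  intro x
  have h1 : HasFDerivAt (fun y : ℝ × ℝ => y.1) (ContinuousLinearMap.fst ℝ ℝ ℝ) x := hasFDerivAt_fst
  have h2 : HasFDerivAt (fun y : ℝ × ℝ => y.2) (ContinuousLinearMap.snd ℝ ℝ ℝ) x := hasFDerivAt_snd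
  have hq := (h1.const_mul (b/3)).add (h2.const_mul (c/3))
  have hv := ((h1.const_mul a).add (hq.mul h1)).prodMk (hq.mul h2)
  have hf := hv.fderiv
  unfold pdiv
  simp only [map_add, map_mul, MvPolynomial.eval_C, MvPolynomial.eval_X, map_zero, zero_mul,
    add_zero, zero_add, Matrix.cons_val_zero, Matrix.cons_val_one]
  erw [hf]
  simp
  ring
end

section
/- Let Ê ⊂ ℝ² be the reference triangle with vertices r̂₁ = (0,0), r̂₂ = (1,0), r̂₃ = (0,1) and centroid r̂₄ = (1/3, 1/3), and let V(Ê) = (P₁)² + x P₁ be the local Raviart–Thomas space RT₁ (dimension 8). Define the eight nodal functionals on V(Ê): at r̂₁, v ↦ ⟨v(r̂₁), (−1,0)⟩ and v ↦ ⟨v(r̂₁), (0,−1)⟩; at r̂₂, v ↦ ⟨v(r̂₂), (0,−1)⟩ and v ↦ ⟨v(r̂₂), (1/√2, 1/√2)⟩; at r̂₃, v ↦ ⟨v(r̂₃), (1/√2, 1/√2)⟩ and v ↦ ⟨v(r̂₃), (−1,0)⟩; at r̂₄, v ↦ ⟨v(r̂₄), (1,0)⟩ and v ↦ ⟨v(r̂₄),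 (0,1)⟩. Then the linear map V(Ê) → ℝ⁸ given by these eight functionals is injective (hence bijective); that is, an element of RT₁ is uniquely determined by the values of its normal components at the two endpoints of each edge together with its two components at the centroid. -/
/-- Euclidean inner product on ℝ². -/
def dot2 (a b : ℝ × ℝ) : ℝ := a.1 * b.1 + a.2 * b.2

theorem affine_aux (p : MvPolynomial (Fin 2) ℝ) (h : p.totalDegree ≤ 1) :
    ∃ a b c : ℝ, ∀ x y : ℝ, MvPolynomial.eval ![x, y] p = a + b * x + c * y := by
  have key : ∀ s : Finset (Fin 2 →₀ ℕ), (∀ d ∈ s, d 0 + d 1 ≤ 1) →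
      ∃ a b c : ℝ, ∀ x y : ℝ,
        ∑ d ∈ s, p.coeff d * (x ^ d 0 * y ^ d 1) = a + b * x + c * y := by
    intro s
    induction s using Finset.induction_on with
    | empty => intro _; exact ⟨0, 0, 0, by simp⟩
    | insert d s hd ih =>
      intro hs
      obtain ⟨a, b, c, habc⟩ := ih (fun e he => hs e (Finset.mem_insert_of_mem he))
      have h1 := hs d (Finset.mem_insert_self d s)
      have h3 : (d 0 = 0 ∧ d 1 = 0) ∨ (d 0 = 1 ∧ d 1 = 0) ∨ (d 0 = 0 ∧ d 1 = 1) := by omega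
      rcases h3 with ⟨u, w⟩ | ⟨u, w⟩ | ⟨u, w⟩
      · refine ⟨a + p.coeff d, b, c, fun x y => ?_⟩
        rw [Finset.sum_insert hd, habc, u, w]; ring
      · refine ⟨a, b + p.coeff d, c, fun x y => ?_⟩
        rw [Finset.sum_insert hd, habc, u, w]; ring
      · refine ⟨a, b, c + p.coeff d, fun x y => ?_⟩
        rw [Finset.sum_insert hd, habc, u, w]; ring
  obtain ⟨a, b, c, habc⟩ := key p.support (by
    intro d hd
    have h2 := (MvPolynomial.le_totalDegree hd).trans h
    rw [Finsupp.sum_fintype _ _ (by simp)] at h2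
    simpa [Fin.sum_univ_two] using h2)
  refine ⟨a, b, c, fun x y => ?_⟩
  rw [← habc, MvPolynomial.eval_eq']
  simp [Fin.prod_univ_two]

/-- Unisolvence of the degrees of freedom of `RT₁` on the reference triangle:
an element of `RT₁ = (P₁)² + x P₁` is uniquely determined by the normal components at
the two endpoints of each edge together with the two components at the centroid. -/
theorem stmt_16 (p₁ p₂ q p₁' p₂' q' : MvPolynomial (Fin 2) ℝ)
    (h₁ : p₁.totalDegree ≤ 1) (h₂ : p₂.totalDegree ≤ 1) (hq : q.totalDegree ≤ 1)
    (h₁' : p₁'.totalDegree ≤ 1) (h₂' : p₂'.totalDegree ≤ 1) (hq' : q'.totalDegree ≤ 1)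
    (v v' : ℝ × ℝ → ℝ × ℝ)
    (hv : ∀ x : ℝ × ℝ,
      v x = (MvPolynomial.eval ![x.1, x.2] p₁ + MvPolynomial.eval ![x.1, x.2] q * x.1,
             MvPolynomial.eval ![x.1, x.2] p₂ + MvPolynomial.eval ![x.1, x.2] q * x.2))
    (hv' : ∀ x : ℝ × ℝ,
      v' x = (MvPolynomial.eval ![x.1, x.2] p₁' + MvPolynomial.eval ![x.1, x.2] q' * x.1,
              MvPolynomial.eval ![x.1, x.2] p₂' + MvPolynomial.eval ![x.1, x.2] q' * x.2))
    (e₁ : dot2 (v (0, 0)) (-1, 0) = dot2 (v' (0, 0)) (-1, 0))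
    (e₂ : dot2 (v (0, 0)) (0, -1) = dot2 (v' (0, 0)) (0, -1))
    (e₃ : dot2 (v (1, 0)) (0, -1) = dot2 (v' (1, 0)) (0, -1))
    (e₄ : dot2 (v (1, 0)) (1 / Real.sqrt 2, 1 / Real.sqrt 2)
        = dot2 (v' (1, 0)) (1 / Real.sqrt 2, 1 / Real.sqrt 2))
    (e₅ : dot2 (v (0, 1)) (1 / Real.sqrt 2, 1 / Real.sqrt 2)
        = dot2 (v' (0, 1)) (1 / Real.sqrt 2, 1 / Real.sqrt 2))
    (e₆ : dot2 (v (0, 1)) (-1, 0) = dot2 (v' (0, 1)) (-1, 0))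
    (e₇ : dot2 (v (1 / 3, 1 / 3)) (1, 0) = dot2 (v' (1 / 3, 1 / 3)) (1, 0))
    (e₈ : dot2 (v (1 / 3, 1 / 3)) (0, 1) = dot2 (v' (1 / 3, 1 / 3)) (0, 1)) :
    ∀ x : ℝ × ℝ, v x = v' x := by
  obtain ⟨a1, b1, c1, f1⟩ := affine_aux p₁ h₁
  obtain ⟨a2, b2, c2, f2⟩ := affine_aux p₂ h₂
  obtain ⟨a, b, c, f⟩ := affine_aux q hq
  obtain ⟨a1', b1', c1', f1'⟩ := affine_aux p₁' h₁'
  obtain ⟨a2', b2', c2', f2'⟩ := affine_aux p₂' h₂'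
  obtain ⟨a', b', c', f'⟩ := affine_aux q' hq'
  have hs : (1 / Real.sqrt 2) ≠ 0 := by positivity
  simp only [hv, hv', f1, f2, f, f1', f2', f', dot2, ← add_mul] at e₁ e₂ e₃ e₄ e₅ e₆ e₇ e₈
  have e4 := mul_right_cancel₀ hs e₄
  have e5 := mul_right_cancel₀ hs e₅
  have k1 : a1 = a1' := by linarith
  have k2 : a2 = a2' := by linarith
  have k3 : b2 = b2' := by linarith
  have k4 : c1 = c1' := by linarith
  have k5 : b = b' := by linarith
  have k6 : c = c' := by linarith
  have k7 : b1 + a = b1' + a' := by linarith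
  have k8 : c2 + a = c2' + a' := by linarith
  rintro ⟨x, y⟩
  simp only [hv, hv', f1, f2, f, f1', f2', f', Prod.mk.injEq]
  subst k1 k2 k3 k4 k5 k6
  constructor
  · linear_combination x * k7
  · linear_combination y * k8
end
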